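/- arXiv:0909.2461 — 3 statements merged into one kernel-verified Lean document; each statement's English description precedes it below -/
import Mathlib

section
/- Let p > 24138 be a prime and let S be a sequence of p elements of ℤ/pℤ \ {0} containing the element 1, such that S contains no nonempty subsequence with index p and such that m(S) = M(S). Put M = M(S) and k = ⌊p/M⌋, and suppose 4 ≤ M ≤ (p−3)/2 and max{(p−M−2)/M, (p−M)/(M+1)} ≤ k ≤ (p+1)/M. Then p = |S| ≤ M + Σ_{i=2}^{k} Σ_{1 ≤ j ≤ i−1, gcd(j,i)=1} (i−1) + Σ_{i=2}^{k} |R_i|, i.e., p ≤ M + Σ_{i=2}^{k} (i−1)φ(i) + Σ_{i=2}^{k} |R_i|. -/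
/-- `|x|ₚ`: the smallest positive integer in the residue class `x` modulo `p`
(so `|0|ₚ = p`). -/
def nval (p : ℕ) (x : ZMod p) : ℕ := if x = 0 then p else x.val

/-- `σ(|mS|ₚ)`: the sum of `|m·a|ₚ` over all terms `a` of `S`. -/
def sigmaM (p : ℕ) (m : ℤ) (S : Multiset (ZMod p)) : ℕ :=
  (S.map fun a => nval p (m • a)).sum

/-- `σ(|S|ₚ)`: the sum of `|a|ₚ` over all terms `a` of `S`. -/
def sigmaOne (p : ℕ) (S : Multiset (ZMod p)) : ℕ :=
  (S.map (nval p)).sum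

/-- `Σ_Index(S) = { σ(|T|ₚ) : T a subsequence of S with 1 ≤ σ(|T|ₚ) ≤ p }`. -/
def SigmaIndex (p : ℕ) (S : Multiset (ZMod p)) : Set ℕ :=
  {s | ∃ T ≤ S, s = sigmaOne p T ∧ 1 ≤ s ∧ s ≤ p}

/-- `M(S)`: the maximal integer `t` such that `Σ_Index(T) = [1, t]` holds for
some subsequence `T` of `S`. -/
noncomputable def Mfun (p : ℕ) (S : Multiset (ZMod p)) : ℕ :=
  sSup {t | ∃ T ≤ S, SigmaIndex p T = Set.Icc 1 t}

/-- `m(S) = max { M(|rS|ₚ) : r ∈ [1, p-1] }`. -/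
noncomputable def mfun (p : ℕ) (S : Multiset (ZMod p)) : ℕ :=
  sSup {t | ∃ r : ℕ, 1 ≤ r ∧ r ≤ p - 1 ∧
    t = Mfun p (S.map fun x => (r : ZMod p) * x)}

/-- `Rᵢ`: the subsequence of `S` consisting of those terms `x` with
`1 ≤ |ix|ₚ ≤ M` and `gcd(|ix|ₚ, i) = 1`. -/
def Rseq (p : ℕ) (M : ℕ) (S : Multiset (ZMod p)) (i : ℕ) : Multiset (ZMod p) :=
  S.filter fun x => 1 ≤ nval p ((i : ZMod p) * x) ∧
    nval p ((i : ZMod p) * x) ≤ M ∧ Nat.Coprime (nval p ((i : ZMod p) * x)) i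

theorem nval_cast (p : ℕ) [NeZero p] (x : ZMod p) : ((nval p x : ℕ) : ZMod p) = x := by
  unfold nval
  split_ifs with h
  · simp [h]
  · simp

theorem nval_pos (p : ℕ) [NeZero p] (x : ZMod p) : 1 ≤ nval p x := by
  unfold nval
  split_ifs with h
  · exact NeZero.one_le
  · have := (ZMod.val_ne_zero x).2 h
    omega

theorem nval_lt (p : ℕ) [NeZero p] (x : ZMod p) (hx : x ≠ 0) : nval p x < p := by
  unfold nval
  rw [if_neg hx]
  exact ZMod.val_lt x

theorem nval_le (p : ℕ) [NeZero p] (x : ZMod p) : nval p x ≤ p := by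
  by_cases hx : x = 0
  · simp [nval, hx]
  · exact (nval_lt p x hx).le

theorem nval_eq_of_cast (p : ℕ) [NeZero p] (x : ZMod p) (y : ℤ) (h0 : 0 < y) (h1 : y < p)
    (h : ((y : ℤ) : ZMod p) = x) : (nval p x : ℤ) = y := by
  have hc : (((nval p x : ℕ) : ℤ) : ZMod p) = ((y : ℤ) : ZMod p) := by
    rw [h]; push_cast; exact nval_cast p x
  rw [ZMod.intCast_eq_intCast_iff_dvd_sub] at hc
  obtain ⟨c, hc⟩ := hc
  have a1 := nval_pos p x
  have a2 := nval_le p x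
  have hpp : (0 : ℤ) < p := by omega
  have : c = 0 := by
    have : c < 1 := by
      by_contra hcon
      nlinarith
    have : -1 < c := by
      by_contra hcon
      nlinarith
    omega
  subst this
  omega

theorem sigmaOne_cons (p : ℕ) (a : ZMod p) (T : Multiset (ZMod p)) :
    sigmaOne p (a ::ₘ T) = nval p a + sigmaOne p T := by
  simp [sigmaOne]

theorem sigmaOne_mono (p : ℕ) {U T : Multiset (ZMod p)} (h : U ≤ T) :
    sigmaOne p U ≤ sigmaOne p T := by
  obtain ⟨V, rfl⟩ := Multiset.le_iff_exists_add.1 h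
  simp [sigmaOne]

theorem card_le_sigmaOne (p : ℕ) [NeZero p] (T : Multiset (ZMod p)) :
    Multiset.card T ≤ sigmaOne p T := by
  induction T using Multiset.induction with
  | empty => simp
  | cons a T ih =>
    rw [sigmaOne_cons, Multiset.card_cons]
    have := nval_pos p a
    omega

theorem sigma_le_of_index (p : ℕ) [NeZero p] (T : Multiset (ZMod p)) (M : ℕ)
    (hT : SigmaIndex p T = Set.Icc 1 M) (hM : 2 * M + 1 ≤ p) :
    ∀ U ≤ T, sigmaOne p U ≤ M := by
  intro U
  induction U using Multiset.induction with
  | empty => intro _; simp [sigmaOne]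
  | cons a U ih =>
    intro hU
    have h1 := ih ((Multiset.le_cons_self U a).trans hU)
    have hp := nval_pos p a
    have ha : nval p a ∈ SigmaIndex p T := by
      refine ⟨{a}, ?_, by simp [sigmaOne], hp, nval_le p a⟩
      rw [Multiset.singleton_le]
      exact Multiset.mem_of_le hU (Multiset.mem_cons_self a U)
    rw [hT] at ha
    have ha2 := ha.2
    have : sigmaOne p (a ::ₘ U) ∈ SigmaIndex p T := by
      refine ⟨_, hU, rfl, ?_, ?_⟩ <;> rw [sigmaOne_cons] <;> omega
    rw [hT] at this
    exact this.2

theorem Mset_bdd (p : ℕ) (S : Multiset (ZMod p)) :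
    BddAbove {t | ∃ T ≤ S, SigmaIndex p T = Set.Icc 1 t} := by
  refine ⟨p, ?_⟩
  rintro t ⟨T, -, hT⟩
  by_cases h : t = 0
  · omega
  · have : t ∈ SigmaIndex p T := by
      rw [hT]; exact ⟨by omega, le_rfl⟩
    obtain ⟨_, _, _, _, h⟩ := this
    exact h

theorem Mset_mem (p : ℕ) (S : Multiset (ZMod p)) :
    ∃ T ≤ S, SigmaIndex p T = Set.Icc 1 (Mfun p S) := by
  have : sSup {t | ∃ T ≤ S, SigmaIndex p T = Set.Icc 1 t} ∈
      {t | ∃ T ≤ S, SigmaIndex p T = Set.Icc 1 t} := by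
    refine Nat.sSup_mem ⟨0, 0, Multiset.zero_le S, ?_⟩ (Mset_bdd p S)
    ext s
    simp only [SigmaIndex, Set.mem_ofPred_eq, Set.mem_Icc, Multiset.le_zero]
    constructor
    · rintro ⟨T, rfl, h, h1, h2⟩
      simp [sigmaOne] at h
      omega
    · omega
  exact this

theorem exists_sub (p : ℕ) (T : Multiset (ZMod p)) (M s : ℕ)
    (hT : SigmaIndex p T = Set.Icc 1 M) (hs : s ≤ M) : ∃ U ≤ T, sigmaOne p U = s := by
  by_cases h : s = 0
  · exact ⟨0, Multiset.zero_le _, by simp [sigmaOne, h]⟩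
  · have : s ∈ SigmaIndex p T := by rw [hT]; exact ⟨by omega, hs⟩
    obtain ⟨U, hU, h, _⟩ := this
    exact ⟨U, hU, h.symm⟩

theorem big_of_rest (p : ℕ) [NeZero p] (S T : Multiset (ZMod p)) (M : ℕ) (hM : M = Mfun p S)
    (hT : SigmaIndex p T = Set.Icc 1 M) (h2 : 2 * M + 1 ≤ p) (x : ZMod p)
    (hx : x ::ₘ T ≤ S) : M + 2 ≤ nval p x := by
  by_contra hcon
  have hpos := nval_pos p x
  have key : SigmaIndex p (x ::ₘ T) = Set.Icc 1 (M + nval p x) := by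
    ext s
    constructor
    · rintro ⟨U, hU, rfl, h, _⟩
      refine ⟨h, (sigmaOne_mono p hU).trans ?_⟩
      rw [sigmaOne_cons]
      have := sigma_le_of_index p T M hT h2 T le_rfl
      omega
    · rintro ⟨ha, hb⟩
      by_cases hs : s ≤ M
      · obtain ⟨U, hU, hU2⟩ := exists_sub p T M s hT hs
        exact ⟨U, hU.trans (Multiset.le_cons_self T x), hU2.symm, ha, by omega⟩
      · obtain ⟨U, hU, hU2⟩ := exists_sub p T M (s - nval p x) hT (by omega)
        refine ⟨x ::ₘ U, (Multiset.cons_le_cons_iff x).2 hU, ?_, ha, by omega⟩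
        rw [sigmaOne_cons]; omega
  have := le_csSup (Mset_bdd p S) ⟨x ::ₘ T, hx, key⟩
  change _ ≤ Mfun p S at this
  omega

theorem exists_sub_card {α : Type*} (W : Multiset α) (i : ℕ) (h : i ≤ Multiset.card W) :
    ∃ V ≤ W, Multiset.card V = i := by
  induction W using Quotient.inductionOn with
  | h l =>
    refine ⟨(l.take i : List α), Multiset.coe_le.2 (List.take_sublist i l).subperm, ?_⟩
    have : i ≤ l.length := by simpa using h
    simp [this]

theorem union_bound {α ι : Type*} (I : Finset ι) (P : ι → α → Prop)
    [∀ i, DecidablePred (P i)] (W : Multiset α)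
    (h : ∀ x ∈ W, ∃ i ∈ I, P i x) : Multiset.card W ≤ ∑ i ∈ I, Multiset.card (W.filter (P i)) := by
  induction W using Multiset.induction with
  | empty => simp
  | cons a W ih =>
    have h1 := ih (fun x hx => h x (Multiset.mem_cons_of_mem hx))
    obtain ⟨i, hi, hP⟩ := h a (Multiset.mem_cons_self a W)
    rw [Multiset.card_cons]
    refine lt_of_le_of_lt h1 (Finset.sum_lt_sum (fun j _ => ?_) ⟨i, hi, ?_⟩)
    · exact Multiset.card_le_card (Multiset.filter_le_filter _ (Multiset.le_cons_self W a))
    · rw [Multiset.filter_cons_of_pos _ hP, Multiset.card_cons]; omega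

theorem sum_affine {α : Type*} (V : Multiset α) (f g : α → ℕ) (m C : ℤ)
    (h : ∀ x ∈ V, (f x : ℤ) = m * g x - C) :
    ((V.map f).sum : ℤ) = m * (V.map g).sum - Multiset.card V * C := by
  induction V using Multiset.induction with
  | empty => simp
  | cons a V ih =>
    have h1 := ih (fun x hx => h x (Multiset.mem_cons_of_mem hx))
    have h2 := h a (Multiset.mem_cons_self a V)
    simp only [Multiset.map_cons, Multiset.sum_cons, Multiset.card_cons]
    rw [Nat.cast_add, Nat.cast_add, Nat.cast_add, h1, h2]; push_cast; ring

theorem sum_bounds {α : Type*} (V : Multiset α) (g : α → ℕ) (i A M : ℤ)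
    (h : ∀ x ∈ V, 1 ≤ A - i * g x ∧ A - i * g x ≤ M) :
    (Multiset.card V : ℤ) ≤ Multiset.card V * A - i * (V.map g).sum ∧
    Multiset.card V * A - i * (V.map g).sum ≤ Multiset.card V * M := by
  induction V using Multiset.induction with
  | empty => simp
  | cons a V ih =>
    have h1 := ih (fun x hx => h x (Multiset.mem_cons_of_mem hx))
    have h2 := h a (Multiset.mem_cons_self a V)
    simp only [Multiset.map_cons, Multiset.sum_cons, Multiset.card_cons]
    rw [Nat.cast_add, Nat.cast_add, Nat.cast_one]
    constructor <;> nlinarith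

theorem no_big_cluster (p : ℕ) [NeZero p] (hp : p.Prime) (S T V : Multiset (ZMod p)) (M : ℕ)
    (hno : ¬ ∃ T ≤ S, T ≠ 0 ∧ ∃ m : ℤ, IsCoprime m (p : ℤ) ∧ sigmaM p m T = p)
    (hT : SigmaIndex p T = Set.Icc 1 M) (h2 : 2 * M + 1 ≤ p) (hTS : T ≤ S)
    (hV : V ≤ S - T) (i j : ℕ) (hi : 2 ≤ i) (hiM : i * M ≤ p) (hij : Nat.Coprime i j) (hip : i < p)
    (hc : Multiset.card V = i)
    (h : ∀ x ∈ V, 1 ≤ (j * p : ℤ) - i * nval p x ∧ (j * p : ℤ) - i * nval p x ≤ M) : False := by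
  have hb := sum_bounds V (nval p) i (j * p) M h
  rw [hc] at hb
  change (i : ℤ) ≤ i * (j * p) - i * (sigmaOne p V : ℕ) ∧ i * (j * p) - i * (sigmaOne p V : ℕ) ≤ (i * M : ℤ) at hb
  have hi0 : (0 : ℤ) < i := by omega
  obtain ⟨s, hs⟩ : ∃ s : ℤ, s = j * p - (sigmaOne p V : ℕ) := ⟨_, rfl⟩
  have hs1 : 1 ≤ s := by
    have : (i : ℤ) * 1 ≤ i * s := by rw [hs]; linarith [hb.1]
    exact le_of_mul_le_mul_left this hi0
  have hs2 : s ≤ M := by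
    have : (i : ℤ) * s ≤ i * M := by rw [hs]; linarith [hb.2]
    exact le_of_mul_le_mul_left this hi0
  obtain ⟨U, hU, hUs⟩ := exists_sub p T M s.toNat hT (by omega)
  have hUs' : (sigmaOne p U : ℤ) = s := by omega
  -- the multiplier
  obtain ⟨m, hmi, hm⟩ := Nat.exists_mul_mod_eq_one_of_coprime hij.symm (by omega : 1 < i)
  have hm0 : 0 < m := by
    rcases Nat.eq_zero_or_pos m with h | h
    · subst h; simp at hm
    · exact h
  obtain ⟨c, hcc⟩ : ∃ c : ℤ, (j * m : ℤ) = 1 + i * c := by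
    refine ⟨((j * m / i : ℕ) : ℤ), ?_⟩
    have := Nat.mod_add_div (j * m) i
    rw [hm] at this
    exact_mod_cast this.symm
  have hmM : (m : ℤ) * M < p := by
    have h1 : (i : ℤ) * M ≤ p := by exact_mod_cast hiM
    have h2 : (m : ℤ) + 1 ≤ i := by exact_mod_cast hmi
    have h3 : (1 : ℤ) ≤ M := hs1.trans hs2
    nlinarith
  have hVm : ∀ x ∈ V, (nval p ((m : ℤ) • x) : ℤ) = m * nval p x - c * p := by
    intro x hx
    obtain ⟨r1, r2⟩ := h x hx
    have hy : (i : ℤ) * (m * nval p x - c * p) = p - m * (j * p - i * nval p x) := by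
      linear_combination (p : ℤ) * hcc
    have hmr : (m : ℤ) * (j * p - i * nval p x) ≤ m * M :=
      mul_le_mul_of_nonneg_left r2 (by omega)
    have hmr1 : (m : ℤ) * 1 ≤ m * (j * p - i * nval p x) :=
      mul_le_mul_of_nonneg_left r1 (by omega)
    have pos : 0 < (m : ℤ) * nval p x - c * p := by
      by_contra hcon
      push Not at hcon
      have := mul_nonpos_of_nonneg_of_nonpos hi0.le hcon
      omega
    refine nval_eq_of_cast p _ _ pos ?_ ?_
    · nlinarith
    · push_cast
      rw [nval_cast]
      simp
  have hUm : ∀ x ∈ U, (nval p ((m : ℤ) • x) : ℤ) = m * nval p x - 0 := by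
    intro x hx
    have h1 : sigmaOne p {x} ≤ M :=
      sigma_le_of_index p T M hT h2 {x} (Multiset.singleton_le.2 (Multiset.mem_of_le hU hx))
    simp only [sigmaOne, Multiset.map_singleton, Multiset.sum_singleton] at h1
    have h3 := nval_pos p x
    have h4 : (m : ℤ) * nval p x ≤ m * M := mul_le_mul_of_nonneg_left (by omega) (by omega)
    refine nval_eq_of_cast p _ _ ?_ (by omega) ?_
    · rw [sub_zero]; exact mul_pos (by omega) (by omega)
    · push_cast
      rw [nval_cast]
      simp
  have eV := sum_affine V _ _ _ _ hVm
  have eU := sum_affine U _ _ _ _ hUm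
  apply hno
  refine ⟨V + U, ?_, ?_, m, ?_, ?_⟩
  · calc V + U ≤ (S - T) + T := add_le_add hV hU
      _ = S := Multiset.sub_add_cancel hTS
  · intro h0
    have := congrArg Multiset.card h0
    simp at this
    rw [this.1] at hc
    simp at hc
    omega
  · rw [Nat.isCoprime_iff_coprime]
    exact (Nat.coprime_of_lt_prime (by omega) (by omega) hp).symm
  · have e1 : sigmaM p m (V + U) = (V.map fun a => nval p ((m : ℤ) • a)).sum +
        (U.map fun a => nval p ((m : ℤ) • a)).sum := by simp [sigmaM]
    have : (sigmaM p m (V + U) : ℤ) = p := by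
      rw [e1, Nat.cast_add, eV, eU, hc]
      change (m : ℤ) * (sigmaOne p V : ℕ) - i * (c * p) +
        (m * (sigmaOne p U : ℕ) - Multiset.card U * 0) = p
      rw [hUs', hs]
      linear_combination (p : ℤ) * hcc
    exact_mod_cast this

theorem dirichlet_step (p : ℕ) (hp : p.Prime) (M k v : ℕ) (hM : 0 < M) (hk : k = p / M) (hkp : k < p)
    (hk0 : 0 < k) (hv1 : M < v) (hv2 : v + M < p) :
    ∃ i j : ℕ, 2 ≤ i ∧ i ≤ k ∧ j < i ∧ Nat.Coprime i j ∧
      ((1 ≤ (j * p : ℤ) - i * v ∧ (j * p : ℤ) - i * v ≤ M) ∨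
       (1 ≤ (i * v : ℤ) - j * p ∧ (i * v : ℤ) - j * p ≤ M)) := by
  obtain ⟨q, hq, hqk⟩ := Real.exists_rat_abs_sub_le_and_den_le ((v : ℝ) / p) hk0
  have hp0 : (0 : ℝ) < p := by exact_mod_cast hp.pos
  have hd0 : (0 : ℝ) < q.den := by exact_mod_cast q.den_pos
  have hlt : p < M * (k + 1) := by
    rw [hk]; exact Nat.lt_mul_div_succ p hM
  have habsR : |(q.den * v : ℝ) - q.num * p| ≤ M := by
    have e : (q.den * v : ℝ) - q.num * p = (q.den * p) * ((v : ℝ) / p - q) := by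
      have : (q : ℝ) = q.num / q.den := Rat.cast_def q
      rw [this]; field_simp
    rw [e, abs_mul, abs_of_pos (mul_pos hd0 hp0)]
    refine (mul_le_mul_of_nonneg_left hq (by positivity)).trans ?_
    have hlt' : (p : ℝ) < M * (k + 1) := by exact_mod_cast hlt
    rw [mul_one_div, div_le_iff₀ (by positivity)]
    nlinarith
  have habs : |(q.den * v : ℤ) - q.num * p| ≤ M := by exact_mod_cast habsR
  rw [abs_le] at habs
  obtain ⟨hl, hr⟩ := habs
  have hd : 0 < q.den := q.den_pos
  have hcop := q.reduced
  generalize q.num = n at *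
  generalize q.den = i at *
  have hn0 : 0 < n := by
    by_contra hcon
    nlinarith
  have hni : n < i := by
    by_contra hcon
    push Not at hcon
    have h1 : (i : ℤ) * p ≤ n * p := mul_le_mul_of_nonneg_right hcon (by omega)
    have h2 : (i : ℤ) * (v + M + 1) ≤ i * p := mul_le_mul_of_nonneg_left (by omega) (by omega)
    nlinarith
  lift n to ℕ using hn0.le
  have hcop' : Nat.Coprime i n := by simpa using hcop.symm
  have hne : (i * v : ℤ) - n * p ≠ 0 := by
    intro h0
    have h1 : i * v = n * p := by zify; linarith
    have : p ∣ i * v := ⟨n, by rw [h1, mul_comm]⟩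
    rcases hp.dvd_mul.1 this with h | h
    · have := Nat.le_of_dvd hd h; omega
    · have := Nat.le_of_dvd (by omega) h; omega
  refine ⟨i, n, by omega, hqk, by omega, hcop', ?_⟩
  omega

/-- Lemma 4.4 (second part): under the stated conditions on `M = M(S)` and
`k = ⌊p/M⌋`, one has `p = |S| ≤ M + ∑_{i=2}^k (i-1)·φ(i) + ∑_{i=2}^k |Rᵢ|`. -/
theorem stmt_10 (p : ℕ) (hp : p.Prime) (hbig : 24138 < p)
    (S : Multiset (ZMod p)) (hcard : Multiset.card S = p)
    (h0 : (0 : ZMod p) ∉ S) (h1 : (1 : ZMod p) ∈ S)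
    (hno : ¬ ∃ T ≤ S, T ≠ 0 ∧ ∃ m : ℤ, IsCoprime m (p : ℤ) ∧ sigmaM p m T = p)
    (hmM : mfun p S = Mfun p S)
    (M k : ℕ) (hM : M = Mfun p S) (hk : k = p / M)
    (hM4 : 4 ≤ M) (hMp : (M : ℚ) ≤ ((p : ℚ) - 3) / 2)
    (hk1 : ((p : ℚ) - M - 2) / M ≤ (k : ℚ))
    (hk2 : ((p : ℚ) - M) / ((M : ℚ) + 1) ≤ (k : ℚ))
    (hk3 : (k : ℚ) ≤ ((p : ℚ) + 1) / M) :
    p ≤ M + (∑ i ∈ Finset.Icc 2 k, (i - 1) * Nat.totient i)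
        + ∑ i ∈ Finset.Icc 2 k, Multiset.card (Rseq p M S i) := by
  have : NeZero p := ⟨hp.pos.ne'⟩
  have h2 : 2 * M + 1 ≤ p := by
    have : (2 * M + 3 : ℚ) ≤ p := by linarith
    have : 2 * M + 3 ≤ p := by exact_mod_cast this
    omega
  obtain ⟨T, hTS, hT⟩ := Mset_mem p S
  rw [← hM] at hT
  have hk0 : 0 < k := by rw [hk]; exact Nat.div_pos (by omega) (by omega)
  have hkp : k < p := by rw [hk]; exact Nat.div_lt_self hp.pos (by omega)
  have hkM : k * M ≤ p := by rw [hk]; exact Nat.div_mul_le_self p M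
  have hcT : Multiset.card T ≤ M :=
    (card_le_sigmaOne p T).trans (sigma_le_of_index p T M hT h2 T le_rfl)
  have hcS : Multiset.card (S - T) + Multiset.card T = p := by
    rw [← Multiset.card_add, Multiset.sub_add_cancel hTS, hcard]
  classical
  let Q : ℕ → ℕ → ZMod p → Prop := fun i j x =>
    1 ≤ (j * p : ℤ) - i * nval p x ∧ (j * p : ℤ) - i * nval p x ≤ M
  let R : ℕ → ZMod p → Prop := fun i x => 1 ≤ nval p ((i : ZMod p) * x) ∧
    nval p ((i : ZMod p) * x) ≤ M ∧ Nat.Coprime (nval p ((i : ZMod p) * x)) i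
  let J : ℕ → Finset ℕ := fun i => (Finset.range i).filter (Nat.Coprime i)
  have cover : ∀ x ∈ S - T, ∃ i ∈ Finset.Icc 2 k, R i x ∨ ∃ j ∈ J i, Q i j x := by
    intro x hx
    have hxT : x ::ₘ T ≤ S := by
      have : {x} + T ≤ (S - T) + T := add_le_add (Multiset.singleton_le.2 hx) le_rfl
      rwa [Multiset.sub_add_cancel hTS, Multiset.singleton_add] at this
    have hx0 : x ≠ 0 := by
      rintro rfl
      exact h0 (Multiset.mem_of_le hxT (Multiset.mem_cons_self _ _))
    have hv1 := big_of_rest p S T M hM hT h2 x hxT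
    have hvp := nval_lt p x hx0
    have hv2 : nval p x + M < p := by
      by_contra hcon
      obtain ⟨U, hU, hUs⟩ := exists_sub p T M (p - nval p x) hT (by omega)
      apply hno
      refine ⟨x ::ₘ U, ((Multiset.cons_le_cons_iff x).2 hU).trans hxT,
        Multiset.cons_ne_zero, 1, isCoprime_one_left, ?_⟩
      have : sigmaM p 1 (x ::ₘ U) = sigmaOne p (x ::ₘ U) := by simp [sigmaM, sigmaOne]
      rw [this, sigmaOne_cons]
      omega
    obtain ⟨i, j, hi2, hik, hji, hij, hor⟩ :=
      dirichlet_step p hp M k (nval p x) (by omega) hk hkp hk0 (by omega) hv2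
    refine ⟨i, Finset.mem_Icc.2 ⟨hi2, hik⟩, ?_⟩
    rcases hor with hor | hor
    · right
      exact ⟨j, Finset.mem_filter.2 ⟨Finset.mem_range.2 hji, hij⟩, hor⟩
    · left
      have hn : (nval p ((i : ZMod p) * x) : ℤ) = i * nval p x - j * p := by
        refine nval_eq_of_cast p _ _ (by omega) (by omega) ?_
        push_cast
        rw [nval_cast]
        simp
      refine ⟨by omega, by omega, ?_⟩
      have hip : Nat.Coprime i p := (Nat.coprime_of_lt_prime (by omega) (by omega) hp).symm
      rw [← Nat.isCoprime_iff_coprime, hn]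
      have h3 : IsCoprime (i : ℤ) (j * p : ℤ) :=
        (Nat.isCoprime_iff_coprime.2 hij).mul_right (Nat.isCoprime_iff_coprime.2 hip)
      obtain ⟨a, b, hab⟩ := h3
      exact ⟨-b, a + b * nval p x, by linear_combination hab⟩
  have hW := union_bound (Finset.Icc 2 k) (fun i x => R i x ∨ ∃ j ∈ J i, Q i j x) (S - T) cover
  have hterm : ∀ i ∈ Finset.Icc 2 k,
      Multiset.card ((S - T).filter (fun x => R i x ∨ ∃ j ∈ J i, Q i j x)) ≤
        (i - 1) * Nat.totient i + Multiset.card (Rseq p M S i) := by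
    intro i hi
    rw [Finset.mem_Icc] at hi
    have hR : Multiset.card ((S - T).filter (R i)) ≤ Multiset.card (Rseq p M S i) := by
      have : Rseq p M S i = S.filter (R i) := by
        unfold Rseq
        congr
      rw [this]
      exact Multiset.card_le_card (Multiset.filter_le_filter _ (Multiset.sub_le_self S T))
    have hQ : Multiset.card ((S - T).filter (fun x => ∃ j ∈ J i, Q i j x)) ≤
        (i - 1) * Nat.totient i := by
      refine (union_bound (J i) (Q i) _ ?_).trans ?_
      · intro x hx
        exact (Multiset.mem_filter.1 hx).2
      · have hb : ∀ j ∈ J i, Multiset.card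
            (((S - T).filter (fun x => ∃ j ∈ J i, Q i j x)).filter (Q i j)) ≤ i - 1 := by
          intro j hj
          simp only [J, Finset.mem_filter, Finset.mem_range] at hj
          by_contra hcon
          obtain ⟨V, hV, hVc⟩ := exists_sub_card _ i (show i ≤ Multiset.card
            (((S - T).filter (fun x => ∃ j ∈ J i, Q i j x)).filter (Q i j)) by omega)
          refine no_big_cluster p hp S T V M hno hT h2 hTS
            (hV.trans ((Multiset.filter_le _ _).trans (Multiset.filter_le _ _))) i j hi.1
            ((Nat.mul_le_mul_right M hi.2).trans hkM) hj.2 (by omega) hVc ?_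
          intro x hx
          exact (Multiset.mem_filter.1 (Multiset.mem_of_le hV hx)).2
        refine (Finset.sum_le_card_nsmul _ _ _ hb).trans ?_
        rw [smul_eq_mul, mul_comm]
        exact le_of_eq rfl
    have hsplit : Multiset.card ((S - T).filter (fun x => R i x ∨ ∃ j ∈ J i, Q i j x)) ≤
        Multiset.card ((S - T).filter (R i)) +
        Multiset.card ((S - T).filter (fun x => ∃ j ∈ J i, Q i j x)) := by
      rw [← Multiset.card_add, Multiset.filter_add_filter, Multiset.card_add]
      exact Nat.le_add_right _ _
    omega
  have hfin := hW.trans (Finset.sum_le_sum hterm)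
  rw [Finset.sum_add_distrib] at hfin
  omega
end

section
/- Let p ≥ 19 be a prime and let j ∈ [2, p−2]. Then |S_{(p,j)}| ≥ (p−1)/6, and the inequality is strict whenever j ∉ {p−3, (p−1)/3}. -/
/-- `S_(p,j) = { i : 1 ≤ i ≤ p/2 and |ij|ₚ < p/2 }`. -/
def Sset (p j : ℕ) : Finset ℕ :=
  (Finset.Icc 1 (p / 2)).filter fun i => 2 * nval p ((i : ZMod p) * (j : ZMod p)) < p

/-- membership in terms of remainders -/
lemma mem_aux (p : ℕ) (hp : p.Prime) (i j : ℕ) (hi : 1 ≤ i) (hi2 : i < p) (hj : 1 ≤ j)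
    (hj2 : j < p) :
    0 < i * j % p ∧ (2 * nval p ((i : ZMod p) * (j : ZMod p)) < p ↔ 2 * (i * j % p) < p) := by
  have h0 : 0 < i * j % p := by
    rcases Nat.eq_zero_or_pos (i * j % p) with h | h
    · exfalso
      rcases (hp.dvd_mul).1 (Nat.dvd_of_mod_eq_zero h) with h | h
      · exact absurd (Nat.le_of_dvd (by omega) h) (by omega)
      · exact absurd (Nat.le_of_dvd (by omega) h) (by omega)
    · exact h
  refine ⟨h0, ?_⟩
  have e : ((i : ZMod p) * (j : ZMod p)) = ((i * j : ℕ) : ZMod p) := by push_cast; rfl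
  have hv : ((i * j : ℕ) : ZMod p).val = i * j % p := ZMod.val_natCast p (i * j)
  have hne : ((i * j : ℕ) : ZMod p) ≠ 0 := by
    intro h
    rw [ZMod.natCast_eq_zero_iff] at h
    have := Nat.mod_eq_zero_of_dvd h
    omega
  rw [e, nval, if_neg hne, hv]

lemma par_aux (p a : ℕ) (hp : 0 < p) : 2 * (a % p) < p ↔ (2 * a / p) % 2 = 0 := by
  have h1 := Nat.div_add_mod a p
  have h2 := Nat.mod_lt a hp
  set d := a / p
  set x := a % p
  by_cases hx : 2 * x < p
  · have : 2 * a / p = 2 * d := by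
      apply Nat.div_eq_of_lt_le <;> nlinarith
    omega
  · have : 2 * a / p = 2 * d + 1 := by
      apply Nat.div_eq_of_lt_le <;> nlinarith
    omega

lemma card_compl_aux (p : ℕ) (hp : p.Prime) (hp3 : 3 ≤ p) (j : ℕ) (hj1 : 1 ≤ j) (hj2 : j < p) :
    (Sset p j).card + (Sset p (p - j)).card = p / 2 := by
  have hS : Sset p (p - j) = (Finset.Icc 1 (p / 2)).filter
      fun i : ℕ => ¬ (2 * nval p ((i : ZMod p) * (j : ZMod p)) < p) := by
    unfold Sset
    apply Finset.filter_congr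
    intro i hi
    rw [Finset.mem_Icc] at hi
    have hip : i < p := by have := hp.two_le; omega
    obtain ⟨a1, a2⟩ := mem_aux p hp i j hi.1 hip hj1 hj2
    obtain ⟨b1, b2⟩ := mem_aux p hp i (p - j) hi.1 hip (by omega) (by omega)
    rw [a2, b2]
    have hs : (i * j + i * (p - j)) % p = 0 := by
      rw [← Nat.mul_add, Nat.add_sub_cancel' hj2.le]; simp
    rw [Nat.add_mod] at hs
    have l1 := Nat.mod_lt (i * j) hp.pos
    have l2 := Nat.mod_lt (i * (p - j)) hp.pos
    set x := i * j % p
    set y := i * (p - j) % p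
    have hxy : x + y = p := by
      obtain ⟨c, hc⟩ := Nat.dvd_of_mod_eq_zero hs
      have : c = 1 := by
        have h1 : c < 2 := by by_contra h; nlinarith
        have h2 : c ≠ 0 := by rintro rfl; omega
        omega
      subst this; omega
    have hodd : 2 * x ≠ p := by
      intro h
      have h2 : 2 ∣ p := ⟨x, h.symm⟩
      rcases (Nat.dvd_prime hp).1 h2 with h | h
      · omega
      · omega
    omega
  rw [hS, Sset, Finset.card_filter_add_card_filter_not]
  simp

/-- the doubled set -/
def Nset (p j : ℕ) : Finset ℕ := (Finset.Ico 1 p).filter fun y => (j * y / p) % 2 = 0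

def Mset (p j : ℕ) : Finset ℕ := (Finset.Ico 1 p).filter fun y => ¬ ((j * y / p) % 2 = 0)

lemma refl_aux (p : ℕ) (hp : p.Prime) (j : ℕ) (hj2 : j < p) (hodd : j % 2 = 1)
    (y : ℕ) (hy1 : 1 ≤ y) (hy2 : y < p) :
    (j * (p - y) / p) % 2 = (j * y / p) % 2 := by
  obtain ⟨h0, -⟩ := mem_aux p hp j y (by omega) hj2 hy1 hy2
  have h1 := Nat.div_add_mod (j * y) p
  have h2 := Nat.mod_lt (j * y) hp.pos
  have h3 : j * y / p < j := by
    rw [Nat.div_lt_iff_lt_mul hp.pos]; exact Nat.mul_lt_mul_of_pos_left hy2 (by omega)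
  set d := j * y / p
  set x := j * y % p
  have : j * (p - y) / p = j - 1 - d := by
    obtain ⟨z, hz⟩ : ∃ z, p = y + z := ⟨p - y, by omega⟩
    obtain ⟨w, hw⟩ : ∃ w, j = d + w + 1 := ⟨j - 1 - d, by omega⟩
    rw [show p - y = z by omega, show j - 1 - d = w by omega]
    have e1 : j * p = j * y + j * z := by rw [hz]; ring
    have e2 : j * p = p * d + w * p + p := by
      conv_lhs => rw [hw]
      ring
    apply Nat.div_eq_of_lt_le
    · omega
    · have : (w + 1) * p = w * p + p := by ring
      omega
  omega

lemma card_Nset (p : ℕ) (hp : p.Prime) (hp3 : 3 ≤ p) (j : ℕ) (hj2 : j < p) (hodd : j % 2 = 1) :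
    (Nset p j).card = 2 * (Sset p j).card := by
  have hpo : p % 2 = 1 := by
    rcases hp.eq_two_or_odd with h | h <;> omega
  have hmem : ∀ i, i ∈ Sset p j ↔ (1 ≤ i ∧ i ≤ p / 2 ∧ (j * (2 * i) / p) % 2 = 0) := by
    intro i
    rw [Sset, Finset.mem_filter, Finset.mem_Icc, and_assoc]
    refine and_congr_right fun h1 => and_congr_right fun h2 => ?_
    rw [(mem_aux p hp i j h1 (by omega) (by omega) hj2).2, par_aux p _ hp.pos,
      show 2 * (i * j) = j * (2 * i) by ring]
  have hun : Nset p j = (Sset p j).image (fun i => 2 * i) ∪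
      (Sset p j).image (fun i => p - 2 * i) := by
    ext y
    simp only [Nset, Finset.mem_filter, Finset.mem_Ico, Finset.mem_union, Finset.mem_image, hmem]
    constructor
    · rintro ⟨⟨h1, h2⟩, h3⟩
      rcases Nat.even_or_odd' y with ⟨c, hc | hc⟩
      · left; refine ⟨c, ⟨by omega, by omega, ?_⟩, hc.symm⟩
        rw [← hc]; exact h3
      · right; refine ⟨(p - y) / 2, ⟨by omega, by omega, ?_⟩, by omega⟩
        rw [show 2 * ((p - y) / 2) = p - y by omega, refl_aux p hp j hj2 hodd y h1 h2]; exact h3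
    · rintro (⟨i, ⟨h1, h2, h3⟩, rfl⟩ | ⟨i, ⟨h1, h2, h3⟩, rfl⟩)
      · exact ⟨⟨by omega, by omega⟩, h3⟩
      · refine ⟨⟨by omega, by omega⟩, ?_⟩
        rw [refl_aux p hp j hj2 hodd (2 * i) (by omega) (by omega)]; exact h3
  rw [hun, Finset.card_union_of_disjoint, Finset.card_image_of_injOn, Finset.card_image_of_injOn]
  · ring
  · intro a ha b hb hab
    have ha := (hmem a).1 ha
    have hb := (hmem b).1 hb
    simp only at hab
    omega
  · intro a ha b hb hab
    simp only at hab
    omega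
  · rw [Finset.disjoint_left]
    intro y h1 h2
    simp only [Finset.mem_image, hmem] at h1 h2
    obtain ⟨a, ha, rfl⟩ := h1
    obtain ⟨b, hb, hab⟩ := h2
    omega

def fib (p j m : ℕ) : Finset ℕ := (Finset.Ico 1 p).filter fun y => j * y / p = m

lemma mem_fib (p j m y : ℕ) (hp : 0 < p) :
    y ∈ fib p j m ↔ (1 ≤ y ∧ y < p ∧ p * m ≤ j * y ∧ j * y < p * m + p) := by
  rw [fib, Finset.mem_filter, Finset.mem_Ico, Nat.div_eq_iff hp, and_assoc, mul_comm m p]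
  refine and_congr_right fun _ => and_congr_right fun _ => and_congr_right fun _ => ?_
  omega

lemma fib_lower (p j q r m : ℕ) (hp : p = q * j + r) (hr : 1 ≤ r) (hj : 1 ≤ j) (hm : m < j) :
    q ≤ (fib p j m).card := by
  have hp0 : 0 < p := by omega
  have h1 := Nat.div_add_mod (p * m) j
  have h2 := Nat.mod_lt (p * m) (show j > 0 by omega)
  set a := p * m / j
  set b := p * m % j
  have : Finset.Icc (a + 1) (a + q) ⊆ fib p j m := by
    intro y hy
    rw [Finset.mem_Icc] at hy
    have e1 : j * (a + 1) ≤ j * y := Nat.mul_le_mul_left _ hy.1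
    have e2 : j * y ≤ j * (a + q) := Nat.mul_le_mul_left _ hy.2
    have e3 : j * y < p * m + p := by nlinarith
    rw [mem_fib _ _ _ _ hp0]
    refine ⟨by linarith [hy.1, Nat.zero_le a], ?_, by nlinarith, e3⟩
    by_contra h
    have : p * (m + 1) ≤ p * j := Nat.mul_le_mul_left _ hm
    nlinarith
  have := Finset.card_le_card this
  simpa using this

lemma fib_upper (p j q r m : ℕ) (hp : p = q * j + r) (hr : 1 ≤ r) (hrj : r < j) :
    (fib p j m).card ≤ q + 1 := by
  have hp0 : 0 < p := by omega
  have h1 := Nat.div_add_mod (p * m + (j - 1)) j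
  have h2 := Nat.mod_lt (p * m + (j - 1)) (show j > 0 by omega)
  set c := (p * m + (j - 1)) / j
  set b := (p * m + (j - 1)) % j
  have : fib p j m ⊆ Finset.Ico c (c + (q + 1)) := by
    intro y hy
    rw [mem_fib _ _ _ _ hp0] at hy
    obtain ⟨-, -, h3, h4⟩ := hy
    rw [Finset.mem_Ico]
    constructor
    · by_contra h
      have : j * (y + 1) ≤ j * c := Nat.mul_le_mul_left _ (by omega)
      have : j * (y + 1) = j * y + j := by ring
      omega
    · by_contra h
      have : j * (c + (q + 1)) ≤ j * y := Nat.mul_le_mul_left _ (by omega)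
      have : j * (c + (q + 1)) = j * c + q * j + j := by ring
      omega
  have := Finset.card_le_card this
  simpa using this

lemma fib_zero (p j q r : ℕ) (hp : p = q * j + r) (hr : 1 ≤ r) (hrj : r < j) :
    (fib p j 0).card ≤ q := by
  have hp0 : 0 < p := by omega
  have : fib p j 0 ⊆ Finset.Icc 1 q := by
    intro y hy
    rw [mem_fib _ _ _ _ hp0] at hy
    obtain ⟨h1, -, h3, h4⟩ := hy
    rw [Finset.mem_Icc]
    refine ⟨h1, ?_⟩
    by_contra h
    have : j * (q + 1) ≤ j * y := Nat.mul_le_mul_left _ (by omega)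
    nlinarith
  have := Finset.card_le_card this
  simpa using this

lemma fib_last (p j q r m : ℕ) (hp : p = q * j + r) (hr : 1 ≤ r) (hrj : r < j) (hm : m + 1 = j) :
    (fib p j m).card ≤ q := by
  have hp0 : 0 < p := by omega
  have hqp : q ≤ p := by nlinarith
  have : fib p j m ⊆ Finset.Ico (p - q) p := by
    intro y hy
    rw [mem_fib _ _ _ _ hp0] at hy
    obtain ⟨h1, h2, h3, h4⟩ := hy
    rw [Finset.mem_Ico]
    refine ⟨?_, h2⟩
    by_contra h
    have : j * (y + q + 1) ≤ j * p := Nat.mul_le_mul_left _ (by omega)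
    have e : p * j = p * m + p := by rw [← hm]; ring
    nlinarith
  have := Finset.card_le_card this
  rw [Nat.card_Ico] at this
  omega

lemma N_sum (p k : ℕ) (hp : 0 < p) :
    (Nset p (2 * k + 1)).card = ∑ t ∈ Finset.range (k + 1), (fib p (2 * k + 1) (2 * t)).card := by
  rw [Finset.card_eq_sum_card_fiberwise (f := fun y => ((2 * k + 1) * y / p) / 2)
    (t := Finset.range (k + 1))]
  · refine Finset.sum_congr rfl fun t _ => ?_
    congr 1
    ext y
    simp only [Nset, fib, Finset.mem_filter]
    constructor
    · rintro ⟨⟨h1, h2⟩, h3⟩; exact ⟨h1, by omega⟩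
    · rintro ⟨h1, h2⟩; exact ⟨⟨h1, by omega⟩, by omega⟩
  · intro y hy
    simp only [Nset, Finset.coe_filter, Finset.mem_Ico, Set.mem_ofPred_eq] at hy
    have : (2 * k + 1) * y / p < 2 * k + 1 := by
      rw [Nat.div_lt_iff_lt_mul hp]; exact Nat.mul_lt_mul_of_pos_left hy.1.2 (by omega)
    simp only [Finset.coe_range, Set.mem_Iio]
    omega

lemma M_sum (p k : ℕ) (hp : 0 < p) :
    (Mset p (2 * k + 1)).card = ∑ t ∈ Finset.range k, (fib p (2 * k + 1) (2 * t + 1)).card := by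
  rw [Finset.card_eq_sum_card_fiberwise (f := fun y => ((2 * k + 1) * y / p) / 2)
    (t := Finset.range k)]
  · refine Finset.sum_congr rfl fun t _ => ?_
    congr 1
    ext y
    simp only [Mset, fib, Finset.mem_filter]
    constructor
    · rintro ⟨⟨h1, h2⟩, h3⟩; exact ⟨h1, by omega⟩
    · rintro ⟨h1, h2⟩; exact ⟨⟨h1, by omega⟩, by omega⟩
  · intro y hy
    simp only [Mset, Finset.coe_filter, Finset.mem_Ico, Set.mem_ofPred_eq] at hy
    have : (2 * k + 1) * y / p < 2 * k + 1 := by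
      rw [Nat.div_lt_iff_lt_mul hp]; exact Nat.mul_lt_mul_of_pos_left hy.1.2 (by omega)
    simp only [Finset.coe_range, Set.mem_Iio]
    omega

lemma NM (p j : ℕ) : (Nset p j).card + (Mset p j).card = p - 1 := by
  rw [Nset, Mset, Finset.card_filter_add_card_filter_not]; simp

lemma bounds (p k q r : ℕ) (hp : p = q * (2 * k + 1) + r) (hr : 1 ≤ r) (hrj : r < 2 * k + 1)
    (hk : 1 ≤ k) :
    q * (k + 1) ≤ (Nset p (2 * k + 1)).card ∧
    (Nset p (2 * k + 1)).card + (q + 1) ≤ 2 * q + k * (q + 1) ∧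
    q * k ≤ (Mset p (2 * k + 1)).card ∧ (Mset p (2 * k + 1)).card ≤ (q + 1) * k := by
  have hp0 : 0 < p := by omega
  rw [N_sum p k hp0, M_sum p k hp0]
  refine ⟨?_, ?_, ?_, ?_⟩
  · have := Finset.card_nsmul_le_sum (Finset.range (k + 1))
      (fun t => (fib p (2 * k + 1) (2 * t)).card) q (fun t ht => by
        rw [Finset.mem_range] at ht
        exact fib_lower p _ q r _ hp hr (by omega) (by omega))
    simp only [Finset.card_range, smul_eq_mul] at this
    linarith
  · obtain ⟨l, rfl⟩ : ∃ l, k = l + 1 := ⟨k - 1, by omega⟩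
    rw [Finset.sum_range_succ, Finset.sum_range_succ']
    have h0 := fib_zero p _ q r hp hr hrj
    have h1 := fib_last p _ q r (2 * (l + 1)) hp hr hrj rfl
    have := Finset.sum_le_card_nsmul (Finset.range l)
      (fun t => (fib p (2 * (l + 1) + 1) (2 * (t + 1))).card) (q + 1) (fun t ht =>
        fib_upper p _ q r _ hp hr hrj)
    simp only [Finset.card_range, smul_eq_mul] at this
    have e : (l + 1) * (q + 1) = l * (q + 1) + (q + 1) := by ring
    simp only [mul_zero]
    omega
  · have := Finset.card_nsmul_le_sum (Finset.range k)
      (fun t => (fib p (2 * k + 1) (2 * t + 1)).card) q (fun t ht => by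
        rw [Finset.mem_range] at ht
        exact fib_lower p _ q r _ hp hr (by omega) (by omega))
    simp only [Finset.card_range, smul_eq_mul] at this
    linarith
  · have := Finset.sum_le_card_nsmul (Finset.range k)
      (fun t => (fib p (2 * k + 1) (2 * t + 1)).card) (q + 1) (fun t ht =>
        fib_upper p _ q r _ hp hr hrj)
    simp only [Finset.card_range, smul_eq_mul] at this
    linarith

lemma main_odd (p : ℕ) (hp : p.Prime) (j : ℕ) (hj1 : 3 ≤ j) (hj2 : j < p)
    (hodd : j % 2 = 1) :
    p - 1 < 6 * (Sset p j).card ∧ 6 * (Sset p j).card ≤ 2 * (p - 1) ∧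
    (j ≠ 3 → 3 * j ≠ 2 * p + 1 → 6 * (Sset p j).card < 2 * (p - 1)) := by
  have hN := card_Nset p hp (by omega) j hj2 hodd
  have hNM := NM p j
  have hd := Nat.div_add_mod p j
  have hrj := Nat.mod_lt p (show j > 0 by omega)
  have hq : 1 ≤ p / j := Nat.div_pos hj2.le (by omega)
  have hr : 1 ≤ p % j := by
    rcases Nat.eq_zero_or_pos (p % j) with h | h
    · rcases (Nat.dvd_prime hp).1 (Nat.dvd_of_mod_eq_zero h) with h | h <;> omega
    · exact h
  obtain ⟨k, rfl⟩ : ∃ k, j = 2 * k + 1 := ⟨j / 2, by omega⟩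
  generalize p / (2 * k + 1) = q at *
  generalize p % (2 * k + 1) = r at *
  have hpe : p = q * (2 * k + 1) + r := by rw [← hd]; ring
  obtain ⟨b1, b2, b3, b4⟩ := bounds p k q r hpe hr hrj (by omega)
  generalize (Nset p (2 * k + 1)).card = N at *
  generalize (Mset p (2 * k + 1)).card = M at *
  generalize (Sset p (2 * k + 1)).card = s at *
  have hpe' : p = 2 * (q * k) + q + r := by rw [hpe]; ring
  have b1' : q * k + q ≤ N := by linarith
  have b2' : N + 1 ≤ q + q * k + k := by linarith
  have b4' : M ≤ q * k + k := by linarith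
  clear b1 b2 b4 hpe hd hodd
  rcases Nat.lt_or_ge q 2 with h | h
  · obtain rfl : q = 1 := by omega
    simp only [one_mul] at *
    omega
  · have hqk : (q - 2) * (k - 1) + q + 2 * k = q * k + 2 := by
      obtain ⟨a, rfl⟩ : ∃ a, q = a + 2 := ⟨q - 2, by omega⟩
      obtain ⟨b, rfl⟩ : ∃ b, k = b + 1 := ⟨k - 1, by omega⟩
      simp only [Nat.add_sub_cancel]; ring
    rcases Nat.lt_or_ge k 2 with hk | hk
    · obtain rfl : k = 1 := by omega
      simp only [mul_one] at *
      omega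
    · rcases Nat.lt_or_ge q 3 with h3 | h3
      · obtain rfl : q = 2 := by omega
        omega
      · have hqk : (q - 3) * (k - 2) + 2 * q + 3 * k = q * k + 6 := by
          obtain ⟨a, rfl⟩ : ∃ a, q = a + 3 := ⟨q - 3, by omega⟩
          obtain ⟨b, rfl⟩ : ∃ b, k = b + 2 := ⟨k - 2, by omega⟩
          simp only [Nat.add_sub_cancel]; ring
        generalize (q - 3) * (k - 2) = w at *
        generalize (q - 2) * (k - 1) = w' at *
        generalize q * k = z at *
        omega

/-- Lemma 5.3: for a prime `p ≥ 19` and `j ∈ [2, p-2]`, one has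
`|S_(p,j)| ≥ (p-1)/6`, with strict inequality whenever
`j ∉ {p-3, (p-1)/3}`. -/
theorem stmt_14 (p : ℕ) (hp : p.Prime) (hp19 : 19 ≤ p)
    (j : ℕ) (hj1 : 2 ≤ j) (hj2 : j ≤ p - 2) :
    (p : ℚ) - 1 ≤ 6 * ((Sset p j).card : ℚ) ∧
    (j ≠ p - 3 → 3 * j ≠ p - 1 → (p : ℚ) - 1 < 6 * ((Sset p j).card : ℚ)) := by
  have key : p - 1 ≤ 6 * (Sset p j).card ∧
      (j ≠ p - 3 → 3 * j ≠ p - 1 → p - 1 < 6 * (Sset p j).card) := by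
    have hpo : p % 2 = 1 := by
      rcases hp.eq_two_or_odd with h | h <;> omega
    rcases Nat.mod_two_eq_zero_or_one j with h | h
    · obtain ⟨-, h2, h3⟩ := main_odd p hp (p - j) (by omega) (by omega) (by omega)
      have hc := card_compl_aux p hp (by omega) j (by omega) (by omega)
      refine ⟨by omega, fun e1 e2 => ?_⟩
      have := h3 (by omega) (by omega)
      omega
    · obtain ⟨h1, -, -⟩ := main_odd p hp j (by omega) (by omega) h
      exact ⟨h1.le, fun _ _ => h1⟩
  have e : ((p - 1 : ℕ) : ℚ) = (p : ℚ) - 1 := by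
    rw [Nat.cast_sub (by omega)]; simp
  rw [← e]
  exact ⟨by exact_mod_cast key.1, fun a b => by exact_mod_cast key.2 a b⟩
end

section
/- Let p be a prime and let k be an integer with 4 ≤ 2k < p/2. Then S_{(p,2k)} = ∪_{t=0}^{k−1} { i ∈ ℤ : 2tp/(4k) < i < (2t+1)p/(4k) } and S_{(p,p−2k)} = ∪_{t=0}^{k−1} { i ∈ ℤ : (2t+1)p/(4k) < i < (2t+2)p/(4k) }; that is, an integer i ∈ [1, p/2] lies in S_{(p,2k)} exactly when ⌊4ki/p⌋ is even, and lies in S_{(p,p−2k)} exactly when ⌊4ki/p⌋ is odd. -/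
/-- The description (5.1)-(5.2) of `S_(p,2k)` and `S_(p,p-2k)` for
`4 ≤ 2k < p/2`: an integer `i ∈ [1, p/2]` lies in `S_(p,2k)` exactly when
`⌊4ki/p⌋` is even, and lies in `S_(p,p-2k)` exactly when `⌊4ki/p⌋` is odd. -/
theorem stmt_15 (p : ℕ) (hp : p.Prime) (k : ℕ)
    (hk4 : 4 ≤ 2 * k) (hkp : 4 * k < p) :
    ∀ i ∈ Finset.Icc 1 (p / 2),
      (i ∈ Sset p (2 * k) ↔ Even (4 * k * i / p)) ∧
      (i ∈ Sset p (p - 2 * k) ↔ Odd (4 * k * i / p)) := by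
  intro i hi
  have hi' := Finset.mem_Icc.mp hi
  obtain ⟨hi1, hi2⟩ := hi'
  have hip : i < p := by omega
  haveI : Fact p.Prime := ⟨hp⟩
  have hodd : p % 2 = 1 := by
    rcases hp.eq_two_or_odd with h | h <;> omega
  have hnd : ¬ p ∣ i * (2 * k) := by
    intro h
    rcases hp.dvd_mul.mp h with h | h
    · have := Nat.le_of_dvd (by omega) h
      omega
    · have := Nat.le_of_dvd (by omega) h
      omega
  have hne : ((i * (2 * k) : ℕ) : ZMod p) ≠ 0 := by
    rwa [Ne, ZMod.natCast_eq_zero_iff]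
  have e1 : (i : ZMod p) * ((2 * k : ℕ) : ZMod p) = ((i * (2 * k) : ℕ) : ZMod p) := by
    push_cast; ring
  have e2 : (i : ZMod p) * ((p - 2 * k : ℕ) : ZMod p) = - ((i * (2 * k) : ℕ) : ZMod p) := by
    rw [Nat.cast_sub (by omega)]
    push_cast [ZMod.natCast_self]; ring
  have hr : 0 < i * (2 * k) % p := Nat.pos_of_ne_zero fun h => hnd (Nat.dvd_of_mod_eq_zero h)
  have hrp : i * (2 * k) % p < p := Nat.mod_lt _ hp.pos
  have n1 : nval p ((i : ZMod p) * ((2 * k : ℕ) : ZMod p)) = i * (2 * k) % p := by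
    rw [e1, nval, if_neg hne, ZMod.val_natCast]
  have n2 : nval p ((i : ZMod p) * ((p - 2 * k : ℕ) : ZMod p)) = p - i * (2 * k) % p := by
    rw [e2, nval, if_neg (neg_ne_zero.mpr hne), ZMod.neg_val, if_neg hne, ZMod.val_natCast]
  have hdm := Nat.div_add_mod (i * (2 * k)) p
  have hq : 4 * k * i / p = 2 * (i * (2 * k) / p) + 2 * (i * (2 * k) % p) / p := by
    have : 4 * k * i = 2 * (i * (2 * k) % p) + p * (2 * (i * (2 * k) / p)) := by
      linarith
    rw [this, Nat.add_mul_div_left _ _ hp.pos, add_comm]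
  have hs : 2 * (i * (2 * k) % p) / p = if 2 * (i * (2 * k) % p) < p then 0 else 1 := by
    split_ifs with h
    · exact Nat.div_eq_of_lt h
    · exact Nat.div_eq_of_lt_le (by omega) (by omega)
  rw [Sset, Sset, Finset.mem_filter, Finset.mem_filter, n1, n2, hq, hs, Nat.even_iff, Nat.odd_iff]
  generalize i * (2 * k) % p = r at *
  split_ifs with h
  · refine ⟨⟨fun _ => by omega, fun _ => ⟨hi, h⟩⟩, ⟨fun h' => by omega, fun _ => by omega⟩⟩
  · refine ⟨⟨fun h' => by omega, fun _ => by omega⟩, ⟨fun h' => by omega, fun _ => ⟨hi, by omega⟩⟩⟩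
end
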